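/- Let ω₁, ω₂ ∈ ℂ with Im(ω₁/ω₂) ≠ 0, and define ℘(z) := 1/z² + ∑_{(m,n) ∈ ℤ×ℤ, (m,n)≠(0,0)} [1/(z − m·ω₁ − n·ω₂)² − 1/(m·ω₁ + n·ω₂)²], the sum taken as an (unordered) tsum over the nonzero lattice index pairs. Then for every z ∈ ℂ such that none of z, z + ω₁, z + ω₂ lies in the lattice {m·ω₁ + n·ω₂ : m, n ∈ ℤ}, one has ℘(z + ω₁) = ℘(z) and ℘(z + ω₂) = ℘(z); that is, ℘ is doubly periodic with periods ω₁ and ω₂. -/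

import Mathlib

/-- The Weierstrass `℘`-function attached to the periods `ω₁, ω₂`:
`℘(z) = 1/z² + ∑'_{(m,n) ≠ (0,0)} (1/(z − mω₁ − nω₂)² − 1/(mω₁ + nω₂)²)`. -/
noncomputable def weierstrassP (ω₁ ω₂ : ℂ) (z : ℂ) : ℂ :=
  1 / z ^ 2 + ∑' p : {p : ℤ × ℤ // p ≠ (0, 0)},
    (1 / (z - (p.1.1 : ℂ) * ω₁ - (p.1.2 : ℂ) * ω₂) ^ 2 -
      1 / ((p.1.1 : ℂ) * ω₁ + (p.1.2 : ℂ) * ω₂) ^ 2)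

/-- The explicit double series over `ℤ × ℤ` agrees with Mathlib's lattice sum. -/
lemma weierstrassP_eq_periodPair (L : PeriodPair) (z : ℂ) :
    weierstrassP L.ω₁ L.ω₂ z = L.weierstrassP z := by
  let e := L.latticeEquivProd.symm.toEquiv
  have he (p : ℤ × ℤ) : ((e p : L.lattice) : ℂ) = p.1 * L.ω₁ + p.2 * L.ω₂ :=
    L.latticeEquiv_symm_apply p
  have hs := (e.hasSum_iff.mpr (L.hasSum_weierstrassP z)).summable
  rw [weierstrassP, ← (e.hasSum_iff.mpr (L.hasSum_weierstrassP z)).tsum_eq,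
    ← hs.tsum_subtype_add_tsum_subtype_compl {(0, 0)}, tsum_singleton]
  congr 1
  · simp [he]
  · exact tsum_congr fun p => by simp only [Function.comp_apply, he, sub_sub]

/-- Two complex numbers with non-real quotient are linearly independent over `ℝ`. -/
lemma linearIndependent_pair_of_im_div_ne_zero {ω₁ ω₂ : ℂ} (hω : (ω₁ / ω₂).im ≠ 0) :
    LinearIndependent ℝ ![ω₁, ω₂] := by
  have h₂ : ω₂ ≠ 0 := by
    rintro rfl
    simp at hω
  refine LinearIndependent.pair_iff.mpr fun s t h => ?_
  have h' : (s : ℂ) * (ω₁ / ω₂) + t = 0 := by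
    field_simp
    simpa [Complex.real_smul, mul_comm] using h
  have hs : s = 0 := by
    have := congrArg Complex.im h'
    simpa [hω] using this
  subst hs
  exact ⟨rfl, by simpa using h'⟩

/-- Double periodicity of the Weierstrass `℘`-function: if `Im (ω₁/ω₂) ≠ 0`
and none of `z`, `z + ω₁`, `z + ω₂` lies in the lattice `{mω₁ + nω₂}`, then
`℘(z + ω₁) = ℘(z)` and `℘(z + ω₂) = ℘(z)`. -/
theorem weierstrassP_doubly_periodic (ω₁ ω₂ : ℂ) (hω : (ω₁ / ω₂).im ≠ 0) (z : ℂ)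
    (hz : ∀ m n : ℤ, z ≠ m * ω₁ + n * ω₂)
    (hz1 : ∀ m n : ℤ, z + ω₁ ≠ m * ω₁ + n * ω₂)
    (hz2 : ∀ m n : ℤ, z + ω₂ ≠ m * ω₁ + n * ω₂) :
    weierstrassP ω₁ ω₂ (z + ω₁) = weierstrassP ω₁ ω₂ z ∧
    weierstrassP ω₁ ω₂ (z + ω₂) = weierstrassP ω₁ ω₂ z := by
  let L : PeriodPair := ⟨ω₁, ω₂, linearIndependent_pair_of_im_div_ne_zero hω⟩
  have hL (w : ℂ) : weierstrassP ω₁ ω₂ w = L.weierstrassP w := weierstrassP_eq_periodPair L w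
  simp only [hL]
  exact ⟨L.weierstrassP_add_coe z ⟨ω₁, L.ω₁_mem_lattice⟩,
    L.weierstrassP_add_coe z ⟨ω₂, L.ω₂_mem_lattice⟩⟩
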